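/- arXiv:1403.3781 — 2 statements merged into one kernel-verified Lean document; each statement's English description precedes it below -/
import Mathlib

section
/- Let H be an infinite-dimensional complex Hilbert space. Suppose for each k ≥ 1 a map G̃ₖ from k-tuples of positive definite invertible bounded operators on H to positive operators on H is given such that: G̃₁(A) = A; each G̃ₖ is regular; each G̃ₖ is positively homogeneous (G̃ₖ(tA₁,…,tAₖ) = t G̃ₖ(A₁,…,Aₖ) for t > 0); each G̃ₖ is concave in the Loewner order; and G̃_{k+1}(A₁,…,Aₖ,1) = G̃ₖ(A₁,…,Aₖ)^{k/(k+1)} for all k and all tuples. Then G̃ₖ coincides with the inductive geometric mean Gₖ for every k ≥ 1. -/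
set_option synthInstance.maxHeartbeats 400000
set_option maxHeartbeats 1000000

noncomputable section

variable {H : Type*} [NormedAddCommGroup H] [InnerProductSpace ℂ H] [CompleteSpace H]

/-- `a` is a positive definite invertible bounded operator. -/
def IsPosDefInv (a : H →L[ℂ] H) : Prop := 0 ≤ a ∧ IsUnit a

/-- The inductive geometric mean: `indGM k` is the geometric mean `G_{k+1}` of `k+1`
operator variables, defined recursively by `G₁(A) = A` and
`G_{k+1}(A₁,…,A_{k+1}) = A_{k+1}^{1/2} Gₖ(A_{k+1}^{-1/2}A₁A_{k+1}^{-1/2},…,A_{k+1}^{-1/2}AₖA_{k+1}^{-1/2})^{k/(k+1)} A_{k+1}^{1/2}`,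
with fractional powers taken via the continuous functional calculus. -/
noncomputable def indGM : (k : ℕ) → (Fin (k + 1) → (H →L[ℂ] H)) → (H →L[ℂ] H)
  | 0, A => A 0
  | (k + 1), A =>
      CFC.sqrt (A (Fin.last (k + 1))) *
        CFC.rpow
          (indGM k (fun i : Fin (k + 1) =>
            CFC.sqrt (Ring.inverse (A (Fin.last (k + 1)))) * A i.castSucc *
              CFC.sqrt (Ring.inverse (A (Fin.last (k + 1))))))
          ((k + 1 : ℝ) / (k + 2)) *
        CFC.sqrt (A (Fin.last (k + 1)))

/-- `a` belongs to the compressed domain `D_p`: viewed as an operator on the range of the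
projection `p`, it is positive definite and invertible, i.e. `a = p a p ≥ 0` and `a` is
invertible in the corner algebra `p B(H) p`. -/
def IsCornerPosDef (p a : H →L[ℂ] H) : Prop :=
  0 ≤ a ∧ p * a * p = a ∧ ∃ b : H →L[ℂ] H, p * b * p = b ∧ a * b = p ∧ b * a = p

open Filter Topology

section CuntzPair

variable {R : Type*} [Ring R] [StarRing R]

/-- A pair of isometries whose range projections are complementary. -/
structure IsCuntzPair (V W : R) : Prop where
  left : star V * V = 1
  right : star W * W = 1
  left_right : star V * W = 0
  right_left : star W * V = 0
  sum : V * star V + W * star W = 1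

/-- The block diagonal sum of `a` and `b` along the pair `V, W`. -/
def blockSum (V W a b : R) : R := V * a * star V + W * b * star W

namespace IsCuntzPair

variable {V W : R} (h : IsCuntzPair V W)
include h

theorem symm : IsCuntzPair W V :=
  ⟨h.right, h.left, h.right_left, h.left_right, by rw [add_comm, h.sum]⟩

theorem left_mul (x : R) : star V * (V * x) = x := by rw [← mul_assoc, h.left, one_mul]

theorem right_mul (x : R) : star W * (W * x) = x := h.symm.left_mul x

theorem left_right_mul (x : R) : star V * (W * x) = 0 := by
  rw [← mul_assoc, h.left_right, zero_mul]

theorem right_left_mul (x : R) : star W * (V * x) = 0 := h.symm.left_right_mul x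

theorem compress_blockSum (a b : R) : star V * blockSum V W a b * V = a := by
  simp [blockSum, mul_add, mul_assoc, h.left_mul, h.left_right_mul, h.left]

theorem blockSum_mul (a b c d : R) :
    blockSum V W a b * blockSum V W c d = blockSum V W (a * c) (b * d) := by
  simp [blockSum, mul_add, add_mul, mul_assoc, h.left_mul, h.left_right_mul, h.right_mul,
    h.right_left_mul]

theorem blockSum_one : blockSum V W 1 1 = 1 := by simp [blockSum, h.sum]

theorem isUnit_blockSum {a b : R} (ha : IsUnit a) (hb : IsUnit b) :
    IsUnit (blockSum V W a b) := by
  obtain ⟨a, rfl⟩ := ha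
  obtain ⟨b, rfl⟩ := hb
  refine ⟨⟨blockSum V W a b, blockSum V W ↑a⁻¹ ↑b⁻¹, ?_, ?_⟩, rfl⟩ <;>
    simp [h.blockSum_mul, h.blockSum_one]

theorem unitary_transition {V' W' : R} (h' : IsCuntzPair V' W') :
    V * star V' + W * star W' ∈ unitary R := by
  rw [Unitary.mem_iff]
  constructor <;>
  simp [mul_add, add_mul, mul_assoc, h.left_mul, h.left_right_mul, h.right_mul,
    h.right_left_mul, h'.left_mul, h'.left_right_mul, h'.right_mul,
    h'.right_left_mul, h.sum, h'.sum]

theorem transition_conj (V' W' a b : R) :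
    star (V * star V' + W * star W') * blockSum V W a b * (V * star V' + W * star W') =
      blockSum V' W' a b := by
  simp [blockSum, mul_add, add_mul, mul_assoc, h.left_mul, h.left_right_mul, h.right_mul,
    h.right_left_mul]

theorem comp : IsCuntzPair (V * V) (V * W * star V + W * star W) := by
  constructor <;>
  simp only [star_mul, star_add, star_star, mul_add, add_mul, mul_assoc, h.left_mul,
    h.left_right_mul, h.right_mul, h.right_left_mul, h.left, h.right_left,
    mul_zero, add_zero, zero_add, h.sum]
  have : V * (V * (star V * star V)) + V * (W * (star W * star V)) = V * star V := by
    simp only [← mul_assoc, ← add_mul]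
    rw [mul_assoc V V, mul_assoc V W, ← mul_add, h.sum, mul_one]
  rw [← add_assoc, this, h.sum]

theorem blockSum_blockSum (a b c : R) :
    blockSum V W (blockSum V W a b) c =
      blockSum (V * V) (V * W * star V + W * star W) a (blockSum V W b c) := by
  simp [blockSum, mul_add, add_mul, mul_assoc, h.left_mul, h.left_right_mul, h.right_mul,
    h.right_left_mul]
  abel

/-- Concatenation of a pair with the second isometry of another one. -/
theorem extend {V' W' : R} (h' : IsCuntzPair V' W') :
    IsCuntzPair (V' * star V + W' * V * star W) (W' * W) := by
  constructor <;>
  simp only [star_mul, star_add, star_star, mul_add, add_mul, mul_assoc, h.left_mul,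
    h.left_right_mul, h.right_mul, h.right_left_mul, h.right, h.left_right,
    h'.left_mul, h'.left_right_mul, h'.right_mul, h'.right_left_mul,
    mul_zero, add_zero, zero_add, h.sum]
  have : W' * (V * (star V * star W')) + W' * (W * (star W * star W')) = W' * star W' := by
    simp only [← mul_assoc, ← add_mul]
    rw [mul_assoc W' V, mul_assoc W' W, ← mul_add, h.sum, mul_one]
  rw [add_assoc, this, h'.sum]

theorem eq_blockSum_of_commute {a : R} (ha : Commute a (W * star W)) :
    a = blockSum V W (star V * a * V) (star W * a * W) := by
  have hV : V * star V = 1 - W * star W := by rw [← h.sum]; abel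
  have haV : Commute a (V * star V) := by rw [hV]; exact (Commute.one_right a).sub_right ha
  have hp : V * star V * (V * star V) = V * star V := by
    simp [mul_assoc, h.left_mul]
  have hq : W * star W * (W * star W) = W * star W := by
    simp [mul_assoc, h.right_mul]
  calc a = a * (V * star V + W * star W) := by rw [h.sum, mul_one]
    _ = a * (V * star V * (V * star V)) + a * (W * star W * (W * star W)) := by
      rw [hp, hq, mul_add]
    _ = V * star V * a * (V * star V) + W * star W * a * (W * star W) := by
      rw [← mul_assoc a (V * star V), ← mul_assoc a (W * star W), haV.eq, ha.eq]
    _ = _ := by simp only [blockSum, mul_assoc]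

end IsCuntzPair

end CuntzPair

theorem IsCuntzPair.blockSum_nonneg {V W a b : H →L[ℂ] H} (ha : 0 ≤ a) (hb : 0 ≤ b) :
    0 ≤ blockSum V W a b :=
  add_nonneg (star_right_conjugate_nonneg ha V) (star_right_conjugate_nonneg hb W)

theorem IsCuntzPair.isPosDefInv_blockSum {V W : H →L[ℂ] H} (h : IsCuntzPair V W)
    {a b : H →L[ℂ] H} (ha : IsPosDefInv a) (hb : IsPosDefInv b) :
    IsPosDefInv (blockSum V W a b) :=
  ⟨blockSum_nonneg ha.1 hb.1, h.isUnit_blockSum ha.2 hb.2⟩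

theorem IsCuntzPair.isCornerPosDef {V W : H →L[ℂ] H} (h : IsCuntzPair V W)
    {a : H →L[ℂ] H} (ha : IsPosDefInv a) :
    IsCornerPosDef (V * star V) (V * a * star V) := by
  refine ⟨star_right_conjugate_nonneg ha.1 V, by simp [mul_assoc, h.left_mul], ?_⟩
  obtain ⟨u, hu⟩ := ha.2
  refine ⟨V * ↑u⁻¹ * star V, by simp [mul_assoc, h.left_mul], ?_, ?_⟩ <;>
    simp [mul_assoc, h.left_mul, ← hu]

theorem IsPosDefInv.conj {a c : H →L[ℂ] H} (ha : IsPosDefInv a) (hc : IsPosDefInv c) :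
    IsPosDefInv (c * a * c) :=
  ⟨conjugate_nonneg_of_nonneg ha.1 hc.1, (hc.2.mul ha.2).mul hc.2⟩

theorem IsPosDefInv.smul {a : H →L[ℂ] H} (ha : IsPosDefInv a) {t : ℝ} (ht : 0 < t) :
    IsPosDefInv (t • a) :=
  IsStrictlyPositive.smul ht ha

theorem IsPosDefInv.add {a b : H →L[ℂ] H} (ha : IsPosDefInv a) (hb : 0 ≤ b) :
    IsPosDefInv (a + b) :=
  IsStrictlyPositive.add_nonneg ha hb

theorem isPosDefInv_one : IsPosDefInv (1 : H →L[ℂ] H) := ⟨zero_le_one, isUnit_one⟩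

theorem le_of_forall_le_one_add_smul {a b : H →L[ℂ] H}
    (h : ∀ ε : ℝ, 0 < ε → a ≤ (1 + ε) • b) : a ≤ b := by
  have hlim : Tendsto (fun ε : ℝ => (1 + ε) • b) (𝓝[>] 0) (𝓝 b) := by
    have : Tendsto (fun ε : ℝ => (1 + ε) • b) (𝓝 0) (𝓝 ((1 + (0 : ℝ)) • b)) :=
      Continuous.tendsto (by fun_prop) 0
    simpa using this.mono_left nhdsWithin_le_nhds
  exact ge_of_tendsto hlim (eventually_mem_nhdsWithin.mono fun ε hε => h ε hε)

/-- Regular, positively homogeneous and concave mappings of `m` operator variables. -/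
structure IsConcaveRegular {m : ℕ} (F : (Fin m → (H →L[ℂ] H)) → (H →L[ℂ] H)) : Prop where
  nonneg : ∀ A, (∀ i, IsPosDefInv (A i)) → 0 ≤ F A
  unitary : ∀ u ∈ unitary (H →L[ℂ] H), ∀ A, (∀ i, IsPosDefInv (A i)) →
    F (fun i => star u * A i * u) = star u * F A * u
  orthogonal : ∀ p q : H →L[ℂ] H, IsSelfAdjoint p → IsIdempotentElem p →
    IsSelfAdjoint q → IsIdempotentElem q → p * q = 0 → ∀ A B : Fin m → (H →L[ℂ] H),
    (∀ i, IsCornerPosDef p (p * A i * p)) → (∀ i, IsCornerPosDef q (q * B i * q)) →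
    F (fun i => p * A i * p + q * B i * q) =
      p * F (fun i => p * A i * p) * p + q * F (fun i => q * B i * q) * q
  homogeneous : ∀ t : ℝ, 0 < t → ∀ A, (∀ i, IsPosDefInv (A i)) →
    F (fun i => t • A i) = t • F A
  concave : ∀ A B, (∀ i, IsPosDefInv (A i)) → (∀ i, IsPosDefInv (B i)) →
    ∀ t : ℝ, 0 ≤ t → t ≤ 1 → t • F A + (1 - t) • F B ≤ F (fun i => t • A i + (1 - t) • B i)

/-- The compression of `F` to a corner isomorphic to the whole algebra. -/
def cornerMap {m : ℕ} (V : H →L[ℂ] H) (F : (Fin m → (H →L[ℂ] H)) → (H →L[ℂ] H))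
    (A : Fin m → (H →L[ℂ] H)) : H →L[ℂ] H :=
  star V * F (fun i => V * A i * star V) * V

namespace IsConcaveRegular

variable {m : ℕ} {F : (Fin m → (H →L[ℂ] H)) → (H →L[ℂ] H)} (hF : IsConcaveRegular F)
include hF

theorem superadditive {A B : Fin m → (H →L[ℂ] H)} (hA : ∀ i, IsPosDefInv (A i))
    (hB : ∀ i, IsPosDefInv (B i)) : F A + F B ≤ F (fun i => A i + B i) := by
  have h2 : (0 : ℝ) < 2 := two_pos
  have h := hF.concave _ _ (fun i => (hA i).smul h2) (fun i => (hB i).smul h2)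
    (1 / 2) (by norm_num) (by norm_num)
  rw [hF.homogeneous 2 h2 A hA, hF.homogeneous 2 h2 B hB] at h
  norm_num [smul_smul] at h
  exact h

theorem monotone {A B : Fin m → (H →L[ℂ] H)} (hA : ∀ i, IsPosDefInv (A i))
    (hAB : ∀ i, A i ≤ B i) : F A ≤ F B := by
  have hB : ∀ i, IsPosDefInv (B i) := fun i => IsStrictlyPositive.of_le (hA i) (hAB i)
  refine le_of_forall_le_one_add_smul fun ε hε => ?_
  rw [← hF.homogeneous _ (by positivity) B hB]
  have hC : ∀ i, IsPosDefInv (ε • B i + (B i - A i)) := fun i =>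
    ((hB i).smul hε).add (sub_nonneg.2 (hAB i))
  have h := hF.superadditive hA hC
  have h0 := hF.nonneg _ hC
  refine le_trans (le_add_of_nonneg_right h0) (h.trans_eq ?_)
  congr 1
  funext i
  rw [add_smul, one_smul]
  abel

theorem map_blockSum_corner {V W : H →L[ℂ] H} (h : IsCuntzPair V W)
    {A B : Fin m → (H →L[ℂ] H)} (hA : ∀ i, IsPosDefInv (A i)) (hB : ∀ i, IsPosDefInv (B i)) :
    F (fun i => blockSum V W (A i) (B i)) =
      blockSum V W (cornerMap V F A) (cornerMap W F B) := by
  have key : ∀ {V W : H →L[ℂ] H}, IsCuntzPair V W → ∀ a,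
      V * star V * (V * a * star V) * (V * star V) = V * a * star V := fun h a => by
    simp [mul_assoc, h.left_mul]
  have e := hF.orthogonal (V * star V) (W * star W) (IsSelfAdjoint.mul_star_self V)
    (by simp [IsIdempotentElem, mul_assoc, h.left_mul]) (IsSelfAdjoint.mul_star_self W)
    (by simp [IsIdempotentElem, mul_assoc, h.right_mul])
    (by simp [mul_assoc, h.left_right_mul])
    (fun i => V * A i * star V) (fun i => W * B i * star W)
    (fun i => by rw [key h]; exact h.isCornerPosDef (hA i))
    (fun i => by rw [key h.symm]; exact h.symm.isCornerPosDef (hB i))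
  simp only [key h, key h.symm] at e
  simp only [blockSum, cornerMap]
  rw [e]
  simp only [mul_assoc]

theorem cornerMap_eq {V W V' W' : H →L[ℂ] H} (h : IsCuntzPair V W) (h' : IsCuntzPair V' W')
    {A : Fin m → (H →L[ℂ] H)} (hA : ∀ i, IsPosDefInv (A i)) :
    cornerMap V' F A = cornerMap V F A := by
  have e := hF.unitary _ (h.unitary_transition h') (fun i => blockSum V W (A i) (A i))
    (fun i => h.isPosDefInv_blockSum (hA i) (hA i))
  simp only [h.transition_conj V' W', hF.map_blockSum_corner h' hA hA,
    hF.map_blockSum_corner h hA hA] at e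
  rw [← h'.compress_blockSum (cornerMap V' F A) (cornerMap W' F A), e, h'.compress_blockSum]

theorem map_blockSum {V₀ W₀ V W : H →L[ℂ] H} (h₀ : IsCuntzPair V₀ W₀) (h : IsCuntzPair V W)
    {A B : Fin m → (H →L[ℂ] H)} (hA : ∀ i, IsPosDefInv (A i)) (hB : ∀ i, IsPosDefInv (B i)) :
    F (fun i => blockSum V W (A i) (B i)) =
      blockSum V W (cornerMap V₀ F A) (cornerMap V₀ F B) := by
  rw [hF.map_blockSum_corner h hA hB, hF.cornerMap_eq h₀ h hA, hF.cornerMap_eq h₀ h.symm hB]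

theorem cornerMap_eq_compress {V W : H →L[ℂ] H} (h : IsCuntzPair V W)
    {A B : Fin m → (H →L[ℂ] H)} (hA : ∀ i, IsPosDefInv (A i)) (hB : ∀ i, IsPosDefInv (B i)) :
    cornerMap V F A = star V * F (fun i => blockSum V W (A i) (B i)) * V := by
  rw [hF.map_blockSum h h hA hB, h.compress_blockSum]

theorem cornerMap_nonneg {V W : H →L[ℂ] H} (h : IsCuntzPair V W)
    {A : Fin m → (H →L[ℂ] H)} (hA : ∀ i, IsPosDefInv (A i)) : 0 ≤ cornerMap V F A := by
  rw [hF.cornerMap_eq_compress h hA hA]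
  exact star_left_conjugate_nonneg
    (hF.nonneg _ fun i => h.isPosDefInv_blockSum (hA i) (hA i)) V

theorem cornerMap_smul {V W : H →L[ℂ] H} (h : IsCuntzPair V W)
    {A : Fin m → (H →L[ℂ] H)} (hA : ∀ i, IsPosDefInv (A i)) {t : ℝ} (ht : 0 < t) :
    cornerMap V F (fun i => t • A i) = t • cornerMap V F A := by
  have hA' : ∀ i, IsPosDefInv (t • A i) := fun i => (hA i).smul ht
  rw [hF.cornerMap_eq_compress h hA hA, hF.cornerMap_eq_compress h hA' hA']
  have : ∀ a : H →L[ℂ] H, blockSum V W (t • a) (t • a) = t • blockSum V W a a := fun a => by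
    simp [blockSum, smul_add]
  simp only [this]
  rw [hF.homogeneous t ht _ fun i => h.isPosDefInv_blockSum (hA i) (hA i)]
  simp

theorem cornerMap_monotone {V W : H →L[ℂ] H} (h : IsCuntzPair V W)
    {A B : Fin m → (H →L[ℂ] H)} (hA : ∀ i, IsPosDefInv (A i)) (hAB : ∀ i, A i ≤ B i) :
    cornerMap V F A ≤ cornerMap V F B := by
  have hB : ∀ i, IsPosDefInv (B i) := fun i => IsStrictlyPositive.of_le (hA i) (hAB i)
  rw [hF.cornerMap_eq_compress h hA hA, hF.cornerMap_eq_compress h hB hA]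
  refine star_left_conjugate_le_conjugate (hF.monotone
    (fun i => h.isPosDefInv_blockSum (hA i) (hA i)) fun i => ?_) V
  exact add_le_add_left (star_right_conjugate_le_conjugate (hAB i) V) _

theorem cornerMap_blockSum {V W : H →L[ℂ] H} (h : IsCuntzPair V W)
    {A B : Fin m → (H →L[ℂ] H)} (hA : ∀ i, IsPosDefInv (A i)) (hB : ∀ i, IsPosDefInv (B i)) :
    cornerMap V F (fun i => blockSum V W (A i) (B i)) =
      blockSum V W (cornerMap V F A) (cornerMap V F B) := by
  have step : ∀ {A B : Fin m → (H →L[ℂ] H)}, (∀ i, IsPosDefInv (A i)) →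
      (∀ i, IsPosDefInv (B i)) →
      cornerMap V F (fun i => blockSum V W (A i) (B i)) =
        blockSum V W (cornerMap V F A)
          (star V * cornerMap V F (fun i => blockSum V W (B i) (B i)) * V) := by
    intro A B hA hB
    rw [hF.cornerMap_eq_compress h (fun i => h.isPosDefInv_blockSum (hA i) (hB i)) hB]
    simp only [h.blockSum_blockSum]
    rw [hF.map_blockSum h h.comp hA fun i => h.isPosDefInv_blockSum (hB i) (hB i)]
    simp [blockSum, mul_add, add_mul, mul_assoc, h.left_mul, h.left_right_mul, h.left,
      h.right_left]
  rw [step hA hB]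
  congr 1
  rw [step hB hB, h.compress_blockSum]

end IsConcaveRegular

theorem IsPosDefInv.exists_smul_one_le {a : H →L[ℂ] H} (ha : IsPosDefInv a) :
    ∃ r : ℝ, 0 < r ∧ r • (1 : H →L[ℂ] H) ≤ a := by
  cases subsingleton_or_nontrivial (H →L[ℂ] H)
  · exact ⟨1, one_pos, (Subsingleton.elim _ _).le⟩
  obtain ⟨r, hr, h⟩ := (CFC.exists_pos_algebraMap_le_iff (A := H →L[ℂ] H)
    (IsSelfAdjoint.of_nonneg ha.1)).2 fun x hx => IsStrictlyPositive.spectrum_pos ha hx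
  exact ⟨r, hr, by rwa [Algebra.algebraMap_eq_smul_one] at h⟩

namespace IsCuntzPair

variable {R : Type*} [Ring R] [StarRing R] {V W : R} (h : IsCuntzPair V W)
include h

theorem reflection_mem_unitary {c s : R} (hc : star c = c) (hs : star s = s)
    (hcs : Commute c s) (hsum : c * c + s * s = 1) :
    V * c * star V + V * s * star W + W * s * star V - W * c * star W ∈ unitary R := by
  have hself : star (V * c * star V + V * s * star W + W * s * star V - W * c * star W) =
      V * c * star V + V * s * star W + W * s * star V - W * c * star W := by
    simp only [star_add, star_sub, star_mul, star_star, hc, hs, mul_assoc]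
    abel
  have key : (V * c * star V + V * s * star W + W * s * star V - W * c * star W) *
      (V * c * star V + V * s * star W + W * s * star V - W * c * star W) = 1 := by
    have e : (V * c * star V + V * s * star W + W * s * star V - W * c * star W) *
        (V * c * star V + V * s * star W + W * s * star V - W * c * star W) =
        V * (c * c + s * s) * star V + W * (c * c + s * s) * star W +
          V * (c * s - s * c) * star W - W * (c * s - s * c) * star V := by
      simp only [mul_add, add_mul, mul_sub, sub_mul, mul_assoc, h.left_mul, h.left_right_mul,
        h.right_mul, h.right_left_mul, mul_zero]
      abel
    rw [e, hsum, hcs.eq]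
    simp [h.sum]
  rw [Unitary.mem_iff, hself]
  exact ⟨key, key⟩

theorem sign_mem_unitary : V * star V - W * star W ∈ unitary R := by
  have := h.reflection_mem_unitary (c := 1) (s := 0) (by simp) (by simp) (Commute.one_left _)
    (by simp)
  simpa using this

end IsCuntzPair

namespace IsConcaveRegular

variable {m : ℕ} {F : (Fin m → (H →L[ℂ] H)) → (H →L[ℂ] H)} (hF : IsConcaveRegular F)
include hF

theorem cornerMap_conj_add {V W : H →L[ℂ] H} (h : IsCuntzPair V W)
    {A B : Fin m → (H →L[ℂ] H)} (hA : ∀ i, IsPosDefInv (A i)) (hB : ∀ i, IsPosDefInv (B i))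
    {c s : H →L[ℂ] H} (hc : IsPosDefInv c) (hs : 0 ≤ s)
    (hcs : Commute c s) (hsum : c * c + s * s = 1) :
    c * cornerMap V F A * c + s * cornerMap V F B * s ≤
      cornerMap V F (fun i => c * A i * c + s * B i * s) := by
  have hc' : star c = c := (IsSelfAdjoint.of_nonneg hc.1).star_eq
  have hs' : star s = s := (IsSelfAdjoint.of_nonneg hs).star_eq
  have hU := h.reflection_mem_unitary hc' hs' hcs hsum
  have hZ := h.sign_mem_unitary
  set U := V * c * star V + V * s * star W + W * s * star V - W * c * star W with hUdef
  set Z := V * star V - W * star W with hZdef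
  have hX : ∀ i, IsPosDefInv (blockSum V W (A i) (B i)) := fun i =>
    h.isPosDefInv_blockSum (hA i) (hB i)
  have conjPos : ∀ u ∈ _root_.unitary (H →L[ℂ] H), ∀ i,
      IsPosDefInv (star u * blockSum V W (A i) (B i) * u) := fun u hu i => by
    have hu' : IsUnit u := (Unitary.toUnits ⟨u, hu⟩).isUnit
    exact ⟨star_left_conjugate_nonneg (hX i).1 u, (hu'.star.mul (hX i).2).mul hu'⟩
  have hUZ : U * Z ∈ _root_.unitary (H →L[ℂ] H) := mul_mem hU hZ
  have hconc := hF.concave _ _ (conjPos U hU) (conjPos _ hUZ) (1 / 2) (by norm_num) (by norm_num)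
  rw [hF.unitary U hU _ hX, hF.unitary _ hUZ _ hX, hF.map_blockSum h h hA hB] at hconc
  have havg : ∀ a b : H →L[ℂ] H, (1 / 2 : ℝ) • (star U * blockSum V W a b * U) +
      (1 - 1 / 2 : ℝ) • (star (U * Z) * blockSum V W a b * (U * Z)) =
      blockSum V W (c * a * c + s * b * s) (s * a * s + c * b * c) := fun a b => by
    simp only [hUdef, hZdef, blockSum, star_add, star_sub, star_mul, star_star, hc', hs', mul_add,
      add_mul, mul_sub, sub_mul, mul_assoc, h.left_mul, h.left_right_mul,
      h.right_mul, h.right_left_mul, mul_zero, add_zero, zero_add, sub_zero, zero_sub, sub_neg_eq_add]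
    module
  simp only [havg] at hconc
  have hres := star_left_conjugate_le_conjugate hconc V
  rw [h.compress_blockSum, ← hF.cornerMap_eq_compress h
    (fun i => (hA i).conj hc |>.add (conjugate_nonneg_of_nonneg (hB i).1 hs))
    (fun i => add_comm (s * A i * s) (c * B i * c) ▸
      ((hB i).conj hc |>.add (conjugate_nonneg_of_nonneg (hA i).1 hs)))] at hres
  exact hres

theorem le_cornerMap_conj_of_le_one {V W : H →L[ℂ] H} (h : IsCuntzPair V W)
    {A : Fin m → (H →L[ℂ] H)} (hA : ∀ i, IsPosDefInv (A i)) {c : H →L[ℂ] H}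
    (hc : IsPosDefInv c) (hc1 : c * c ≤ 1) :
    c * cornerMap V F A * c ≤ cornerMap V F (fun i => c * A i * c) := by
  have hcAc : ∀ i, IsPosDefInv (c * A i * c) := fun i => (hA i).conj hc
  refine le_of_forall_le_one_add_smul fun ε hε => ?_
  rw [← hF.cornerMap_smul h hcAc (by positivity)]
  choose r hr hrle using fun i => (hcAc i).exists_smul_one_le
  have hB : ∀ i, IsPosDefInv ((ε * r i) • (1 : H →L[ℂ] H)) := fun i =>
    isPosDefInv_one.smul (mul_pos hε (hr i))
  have h1 : 0 ≤ 1 - c * c := sub_nonneg.2 hc1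
  set s := CFC.sqrt (1 - c * c) with hs
  have hs0 : 0 ≤ s := CFC.sqrt_nonneg _
  have hss : s * s = 1 - c * c := CFC.sqrt_mul_sqrt_self _ h1
  have hcs : Commute c s := by
    have : Commute (1 - c * c) c :=
      (Commute.one_left c).sub_left ((Commute.refl c).mul_left (Commute.refl c))
    exact (this.cfcₙ_nnreal _).symm
  have hcc : 0 ≤ c * c := by
    simpa using conjugate_nonneg_of_nonneg (zero_le_one (α := H →L[ℂ] H)) hc.1
  have hmain := hF.cornerMap_conj_add h hA hB hc hs0 hcs (by rw [hss]; abel)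
  refine (le_add_of_nonneg_right
    (conjugate_nonneg_of_nonneg (hF.cornerMap_nonneg h hB) hs0)).trans (hmain.trans ?_)
  refine hF.cornerMap_monotone h
    (fun i => (hcAc i).add (conjugate_nonneg_of_nonneg (hB i).1 hs0)) fun i => ?_
  have : s * (ε * r i) • (1 : H →L[ℂ] H) * s ≤ (ε * r i) • 1 := by
    rw [mul_smul_comm, mul_one, smul_mul_assoc, hss]
    exact smul_le_smul_of_nonneg_left (sub_le_self _ hcc) (mul_pos hε (hr i)).le
  rw [add_smul, one_smul]
  refine add_le_add_right (this.trans ?_) _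
  rw [mul_smul]
  exact smul_le_smul_of_nonneg_left (hrle i) hε.le

theorem le_cornerMap_conj {V W : H →L[ℂ] H} (h : IsCuntzPair V W)
    {A : Fin m → (H →L[ℂ] H)} (hA : ∀ i, IsPosDefInv (A i)) {c : H →L[ℂ] H}
    (hc : IsPosDefInv c) :
    c * cornerMap V F A * c ≤ cornerMap V F (fun i => c * A i * c) := by
  obtain ⟨t, ht, htc⟩ : ∃ t : ℝ, 0 < t ∧ (t • c) * (t • c) ≤ 1 := by
    refine ⟨(‖c‖ + 1)⁻¹, by positivity, ?_⟩
    have hn : ‖((‖c‖ + 1)⁻¹ • c) * ((‖c‖ + 1)⁻¹ • c)‖ ≤ 1 := by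
      have : ‖(‖c‖ + 1)⁻¹ • c‖ ≤ 1 := by
        rw [norm_smul, norm_inv, Real.norm_of_nonneg (by positivity), inv_mul_le_iff₀ (by positivity)]
        linarith
      exact (norm_mul_le _ _).trans (mul_le_one₀ this (norm_nonneg _) this)
    have hself : IsSelfAdjoint c := .of_nonneg hc.1
    have hpos : 0 ≤ ((‖c‖ + 1)⁻¹ • c) * ((‖c‖ + 1)⁻¹ • c) := by
      have := star_mul_self_nonneg ((‖c‖ + 1)⁻¹ • c)
      rwa [star_smul, star_trivial, hself.star_eq] at this
    exact (CStarAlgebra.norm_le_one_iff_of_nonneg _ hpos).1 hn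
  have h1 := hF.le_cornerMap_conj_of_le_one h hA (hc.smul ht) htc
  have h2 : ∀ a : H →L[ℂ] H, t • c * a * t • c = (t * t) • (c * a * c) := fun a => by
    simp [smul_smul]
  simp only [h2] at h1
  rw [hF.cornerMap_smul h (fun i => (hA i).conj hc) (mul_pos ht ht)] at h1
  exact (smul_le_smul_iff_of_pos_left (mul_pos ht ht)).1 h1

theorem cornerMap_conj {V W : H →L[ℂ] H} (h : IsCuntzPair V W)
    {A : Fin m → (H →L[ℂ] H)} (hA : ∀ i, IsPosDefInv (A i)) {c d : H →L[ℂ] H}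
    (hc : IsPosDefInv c) (hd : IsPosDefInv d) (hcd : c * d = 1) (hdc : d * c = 1) :
    cornerMap V F (fun i => c * A i * c) = c * cornerMap V F A * c := by
  refine le_antisymm ?_ (hF.le_cornerMap_conj h hA hc)
  have h1 := conjugate_le_conjugate_of_nonneg
    (hF.le_cornerMap_conj h (fun i => (hA i).conj hc) hd) hc.1
  have h2 : ∀ a : H →L[ℂ] H, d * (c * a * c) * d = a := fun a => by
    rw [mul_assoc c, ← mul_assoc d, hdc, one_mul, mul_assoc, hcd, mul_one]
  have h3 : ∀ a : H →L[ℂ] H, c * (d * a * d) * c = a := fun a => by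
    rw [mul_assoc d, ← mul_assoc c, hcd, one_mul, mul_assoc, hdc, mul_one]
  simpa only [h2, h3] using h1

end IsConcaveRegular

theorem IsCuntzPair.rpow_blockSum {V W : H →L[ℂ] H} (h : IsCuntzPair V W) {a : H →L[ℂ] H}
    (ha : 0 ≤ a) {r : ℝ} (hr : 0 ≤ r) :
    CFC.rpow (blockSum V W a a) r = blockSum V W (CFC.rpow a r) (CFC.rpow a r) := by
  let φ : (H →L[ℂ] H) →⋆ₐ[ℝ] (H →L[ℂ] H) :=
    { toFun := fun a => blockSum V W a a
      map_one' := h.blockSum_one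
      map_mul' := fun a b => (h.blockSum_mul a a b b).symm
      map_zero' := by simp [blockSum]
      map_add' := fun a b => by simp only [blockSum, mul_add, add_mul]; abel
      commutes' := fun r => by
        simp [blockSum, Algebra.algebraMap_eq_smul_one, ← smul_add, h.sum]
      map_star' := fun a => by simp [blockSum, mul_assoc] }
  have hφ : Continuous φ := by
    change Continuous fun a : H →L[ℂ] H => V * a * star V + W * a * star W
    fun_prop
  change (blockSum V W a a) ^ r = φ (a ^ r)
  rw [CFC.rpow_eq_cfc_real ha, CFC.rpow_eq_cfc_real (blockSum_nonneg ha ha)]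
  exact (StarAlgHom.map_cfc φ _ a (Real.continuous_rpow_const hr).continuousOn hφ
    (IsSelfAdjoint.of_nonneg ha) (IsSelfAdjoint.of_nonneg (blockSum_nonneg ha ha))).symm

theorem IsPosDefInv.sqrt {a : H →L[ℂ] H} (ha : IsPosDefInv a) : IsPosDefInv (CFC.sqrt a) :=
  IsStrictlyPositive.sqrt a ha

theorem IsPosDefInv.inverse {a : H →L[ℂ] H} (ha : IsPosDefInv a) :
    IsPosDefInv (Ring.inverse a) :=
  IsStrictlyPositive.ringInverse ha

theorem IsPosDefInv.sqrt_mul_sqrt_inverse {a : H →L[ℂ] H} (ha : IsPosDefInv a) :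
    CFC.sqrt a * CFC.sqrt (Ring.inverse a) = 1 := by
  rw [CFC.sqrt_ringInverse, Ring.mul_inverse_cancel _ ha.sqrt.2]

theorem IsPosDefInv.sqrt_inverse_mul_sqrt {a : H →L[ℂ] H} (ha : IsPosDefInv a) :
    CFC.sqrt (Ring.inverse a) * CFC.sqrt a = 1 := by
  rw [CFC.sqrt_ringInverse, Ring.inverse_mul_cancel _ ha.sqrt.2]

theorem cornerMap_eq_indGM
    {G : (k : ℕ) → (Fin (k + 1) → (H →L[ℂ] H)) → (H →L[ℂ] H)}
    (hG : ∀ k, IsConcaveRegular (G k))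
    (hbase : ∀ A : Fin 1 → (H →L[ℂ] H), IsPosDefInv (A 0) → G 0 A = A 0)
    (hupd : ∀ k, ∀ A : Fin (k + 1) → (H →L[ℂ] H), (∀ i, IsPosDefInv (A i)) →
      G (k + 1) (Fin.snoc A 1) = CFC.rpow (G k A) ((k + 1 : ℝ) / (k + 2)))
    {V W : H →L[ℂ] H} (h : IsCuntzPair V W) (k : ℕ) (A : Fin (k + 1) → (H →L[ℂ] H))
    (hA : ∀ i, IsPosDefInv (A i)) : cornerMap V (G k) A = indGM k A := by
  induction k with
  | zero =>
    rw [(hG 0).cornerMap_eq_compress h hA hA, hbase _ (h.isPosDefInv_blockSum (hA 0) (hA 0)),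
      h.compress_blockSum, indGM]
  | succ k ih =>
    have hl := hA (Fin.last (k + 1))
    set d := CFC.sqrt (A (Fin.last (k + 1))) with hd
    set c := CFC.sqrt (Ring.inverse (A (Fin.last (k + 1)))) with hc
    have hdc : d * c = 1 := hl.sqrt_mul_sqrt_inverse
    have hcd : c * d = 1 := hl.sqrt_inverse_mul_sqrt
    have hcp : IsPosDefInv c := hl.inverse.sqrt
    set A' : Fin (k + 1) → (H →L[ℂ] H) := fun i => c * A i.castSucc * c with hA'
    have hA'p : ∀ i, IsPosDefInv (A' i) := fun i => (hA i.castSucc).conj hcp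
    have hsnoc : ∀ i, IsPosDefInv ((Fin.snoc A' 1 : Fin (k + 2) → (H →L[ℂ] H)) i) := by
      refine Fin.lastCases ?_ fun i => ?_
      · rw [Fin.snoc_last]; exact isPosDefInv_one
      · rw [Fin.snoc_castSucc]; exact hA'p i
    have hAeq : A = fun i => d * (Fin.snoc A' 1 : Fin (k + 2) → (H →L[ℂ] H)) i * d := by
      funext i
      refine Fin.lastCases ?_ (fun i => ?_) i
      · rw [Fin.snoc_last, mul_one, hd, CFC.sqrt_mul_sqrt_self _ hl.1]
      · rw [Fin.snoc_castSucc, hA']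
        simp only
        rw [mul_assoc c, ← mul_assoc d, hdc, one_mul, mul_assoc, hcd, mul_one]
    have hconj : cornerMap V (G (k + 1)) A =
        d * cornerMap V (G (k + 1)) (Fin.snoc A' 1) * d := by
      conv_lhs => rw [hAeq]
      exact (hG (k + 1)).cornerMap_conj h hsnoc hl.sqrt hcp hdc hcd
    have hblock : (fun i => blockSum V W ((Fin.snoc A' 1 : Fin (k + 2) → (H →L[ℂ] H)) i)
        ((Fin.snoc A' 1 : Fin (k + 2) → (H →L[ℂ] H)) i)) =
        Fin.snoc (fun i => blockSum V W (A' i) (A' i)) 1 := by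
      funext i
      refine Fin.lastCases ?_ (fun i => ?_) i
      · simp only [Fin.snoc_last, h.blockSum_one]
      · simp only [Fin.snoc_castSucc]
    rw [hconj, (hG (k + 1)).cornerMap_eq_compress h hsnoc hsnoc, hblock,
      hupd k _ fun i => h.isPosDefInv_blockSum (hA'p i) (hA'p i),
      (hG k).map_blockSum h h hA'p hA'p,
      h.rpow_blockSum ((hG k).cornerMap_nonneg h hA'p) (by positivity), h.compress_blockSum,
      ih A' hA'p, indGM]

namespace HilbertBasis

variable {ι : Type*} (b : HilbertBasis ι ℂ H)

/-- The isometry of `H` sending `b i` to `b (f i)`. -/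
def mapInjective (f : ι → ι) (hf : Function.Injective f) : H →L[ℂ] H :=
  ((b.orthonormal.comp f hf).orthogonalFamily.linearIsometry.comp
    b.repr.toLinearIsometry).toContinuousLinearMap

theorem mapInjective_apply (f : ι → ι) (hf : Function.Injective f) (i : ι) :
    b.mapInjective f hf (b i) = b (f i) := by
  classical
  have h := (b.orthonormal.comp f hf).orthogonalFamily.linearIsometry_apply_single
    (i := i) (1 : ℂ)
  rw [← b.repr_self i] at h
  exact h.trans (by simp)

theorem star_mapInjective_mul_self (f : ι → ι) (hf : Function.Injective f) :
    star (b.mapInjective f hf) * b.mapInjective f hf = 1 :=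
  (ContinuousLinearMap.norm_map_iff_adjoint_comp_self _).1 (LinearIsometry.norm_map _)

theorem dense_span_range : Dense (Submodule.span ℂ (Set.range b) : Set H) := by
  rw [dense_iff_closure_eq, ← Submodule.topologicalClosure_coe, b.dense_span]
  rfl

theorem clm_ext {S T : H →L[ℂ] H} (h : ∀ i, S (b i) = T (b i)) : S = T :=
  ContinuousLinearMap.ext_on b.dense_span_range (by rintro _ ⟨i, rfl⟩; exact h i)

theorem star_mapInjective_apply (f : ι → ι) (hf : Function.Injective f) (i : ι) :
    star (b.mapInjective f hf) (b (f i)) = b i := by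
  have := congrArg (fun T : H →L[ℂ] H => T (b i)) (b.star_mapInjective_mul_self f hf)
  simpa [mapInjective_apply] using this

theorem star_mapInjective_apply_eq_zero (f : ι → ι) (hf : Function.Injective f) {j : ι}
    (hj : ∀ i, f i ≠ j) : star (b.mapInjective f hf) (b j) = 0 := by
  rw [← b.repr.map_eq_zero_iff]
  ext i
  rw [b.repr_apply_apply, ContinuousLinearMap.star_eq_adjoint,
    ContinuousLinearMap.adjoint_inner_right, mapInjective_apply, b.orthonormal.2 (hj i)]
  rfl

end HilbertBasis

theorem tendsto_apply_zero_of_dense {T : ℕ → H →L[ℂ] H} (hT : ∀ n, ‖T n‖ ≤ 1) {s : Set H}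
    (hs : Dense (Submodule.span ℂ s : Set H))
    (h : ∀ x ∈ s, Tendsto (fun n => T n x) atTop (𝓝 0)) (x : H) :
    Tendsto (fun n => T n x) atTop (𝓝 0) := by
  have hspan : ∀ y ∈ Submodule.span ℂ s, Tendsto (fun n => T n y) atTop (𝓝 0) := by
    intro y hy
    induction hy using Submodule.span_induction with
    | mem y hy => exact h y hy
    | zero => simp
    | add y z _ _ hy hz => simpa using hy.add hz
    | smul c y _ hy => simpa using hy.const_smul c
  rw [Metric.tendsto_atTop]
  intro ε hε
  obtain ⟨y, hy, hxy⟩ := hs.exists_dist_lt x (half_pos hε)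
  obtain ⟨N, hN⟩ := Metric.tendsto_atTop.1 (hspan y hy) _ (half_pos hε)
  refine ⟨N, fun n hn => ?_⟩
  have h1 := hN n hn
  have h2 : ‖T n (x - y)‖ ≤ ‖x - y‖ :=
    (T n).le_of_opNorm_le_of_le (hT n) le_rfl |>.trans_eq (one_mul _)
  rw [dist_eq_norm] at hxy
  rw [dist_zero_right] at h1 ⊢
  calc ‖T n x‖ = ‖T n (x - y) + T n y‖ := by rw [← map_add, sub_add_cancel]
    _ ≤ ‖T n (x - y)‖ + ‖T n y‖ := norm_add_le _ _
    _ < ε := by linarith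

theorem norm_le_one_of_star_mul_self {T : H →L[ℂ] H} (h : star T * T = 1) : ‖T‖ ≤ 1 :=
  T.opNorm_le_bound zero_le_one fun x => by
    rw [(ContinuousLinearMap.norm_map_iff_adjoint_comp_self T).2 h x, one_mul]

theorem exists_isCuntzPair_tendsto (hH : ¬ FiniteDimensional ℂ H) :
    ∃ V W : H →L[ℂ] H, IsCuntzPair V W ∧
      ∀ x, Tendsto (fun n => (star W ^ n) x) atTop (𝓝 0) := by
  obtain ⟨w, b, -⟩ := exists_hilbertBasis ℂ H
  have hw : Infinite w := by
    by_contra hfin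
    have := not_infinite_iff_finite.1 hfin
    have := Fintype.ofFinite w
    exact hH (Module.Basis.finiteDimensional_of_finite b.toOrthonormalBasis.toBasis)
  obtain ⟨e⟩ : Nonempty (w × ℕ ≃ w) := by
    rw [← Cardinal.eq]
    simp
  let f : w → w := fun i => e (i, 0)
  let g : w → w := fun i => e ((e.symm i).1, (e.symm i).2 + 1)
  have hf : Function.Injective f := fun i j hij => by simpa [f] using hij
  have hg : Function.Injective g := fun i j hij => by
    apply e.symm.injective
    rw [Prod.ext_iff]
    simpa [g] using hij
  have hfg : ∀ i j, f i ≠ g j := fun i j => by simp [f, g]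
  have hcov : ∀ j, (∃ i, f i = j) ∨ ∃ i, g i = j := fun j => by
    obtain ⟨⟨i, n⟩, rfl⟩ := e.surjective j
    cases n with
    | zero => exact Or.inl ⟨i, rfl⟩
    | succ n => exact Or.inr ⟨e (i, n), by simp [g]⟩
  have hV := b.star_mapInjective_mul_self f hf
  have hW := b.star_mapInjective_mul_self g hg
  refine ⟨b.mapInjective f hf, b.mapInjective g hg, ⟨hV, hW, b.clm_ext fun i => ?_,
    b.clm_ext fun i => ?_, b.clm_ext fun i => ?_⟩, fun x => ?_⟩
  · simp [b.mapInjective_apply, b.star_mapInjective_apply_eq_zero f hf fun j => hfg j i]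
  · simp [b.mapInjective_apply, b.star_mapInjective_apply_eq_zero g hg fun j => (hfg i j).symm]
  · obtain ⟨j, rfl⟩ | ⟨j, rfl⟩ := hcov i
    · simp [b.mapInjective_apply, b.star_mapInjective_apply,
        b.star_mapInjective_apply_eq_zero g hg fun k => (hfg j k).symm]
    · simp [b.mapInjective_apply, b.star_mapInjective_apply,
        b.star_mapInjective_apply_eq_zero f hf fun k => hfg k j]
  · refine tendsto_apply_zero_of_dense (fun n => ?_) b.dense_span_range ?_ x
    · rw [← star_pow, norm_star]
      refine norm_le_one_of_star_mul_self ?_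
      induction n with
      | zero => simp
      | succ n ih =>
        rw [pow_succ', star_mul, mul_assoc, ← mul_assoc (star (b.mapInjective g hg)), hW,
          one_mul, ih]
    · rintro _ ⟨i, rfl⟩
      have hzero : ∀ n i, (star (b.mapInjective g hg) ^ (n + 1)) (b (e (i, n))) = 0 := by
        intro n
        induction n with
        | zero =>
          intro i
          rw [zero_add, pow_one]
          exact b.star_mapInjective_apply_eq_zero g hg fun j => by simp [g]
        | succ n ih =>
          intro i
          have : e (i, n + 1) = g (e (i, n)) := by simp [g]
          rw [pow_succ, mul_apply_eq_comp, this, b.star_mapInjective_apply, ih]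
      obtain ⟨⟨i, n⟩, rfl⟩ := e.surjective i
      refine tendsto_const_nhds.congr' ((eventually_ge_atTop (n + 1)).mono fun m hm => ?_)
      change 0 = (star (b.mapInjective g hg) ^ m) _
      rw [← Nat.sub_add_cancel hm, pow_add, mul_apply_eq_comp, hzero, map_zero]

theorem IsCuntzPair.exists_pow {V W : H →L[ℂ] H} (h : IsCuntzPair V W) (n : ℕ) :
    ∃ V', IsCuntzPair V' (W ^ (n + 1)) := by
  induction n with
  | zero => exact ⟨V, by simpa using h⟩
  | succ n ih =>
    obtain ⟨V', h'⟩ := ih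
    exact ⟨_, by simpa [pow_succ] using h.extend h'⟩

/-- Convergence of a bounded sequence of operators in the strong operator topology. -/
structure StrongTendsto (T : ℕ → H →L[ℂ] H) (S : H →L[ℂ] H) : Prop where
  bounded : ∃ L, ∀ n, ‖T n‖ ≤ L
  tendsto : ∀ x, Tendsto (fun n => T n x) atTop (𝓝 (S x))

namespace StrongTendsto

variable {T T' : ℕ → H →L[ℂ] H} {S S' : H →L[ℂ] H}

theorem const (S : H →L[ℂ] H) : StrongTendsto (fun _ => S) S :=
  ⟨⟨‖S‖, fun _ => le_rfl⟩, fun _ => tendsto_const_nhds⟩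

theorem add (h : StrongTendsto T S) (h' : StrongTendsto T' S') :
    StrongTendsto (fun n => T n + T' n) (S + S') := by
  obtain ⟨L, hL⟩ := h.bounded
  obtain ⟨L', hL'⟩ := h'.bounded
  exact ⟨⟨L + L', fun n => norm_add_le_of_le (hL n) (hL' n)⟩,
    fun x => by simpa using (h.tendsto x).add (h'.tendsto x)⟩

theorem mul (h : StrongTendsto T S) (h' : StrongTendsto T' S') :
    StrongTendsto (fun n => T n * T' n) (S * S') := by
  obtain ⟨L, hL⟩ := h.bounded
  obtain ⟨L', hL'⟩ := h'.bounded
  refine ⟨⟨L * L', fun n => norm_mul_le_of_le (hL n) (hL' n)⟩, fun x => ?_⟩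
  have h0 : Tendsto (fun n => L * ‖T' n x - S' x‖) atTop (𝓝 0) := by
    simpa using (tendsto_iff_norm_sub_tendsto_zero.1 (h'.tendsto x)).const_mul L
  have h1 : Tendsto (fun n => T n (T' n x - S' x)) atTop (𝓝 0) :=
    squeeze_zero_norm (fun n => (T n).le_of_opNorm_le (hL n) _) h0
  simpa using h1.add (h.tendsto (S' x))

theorem smul (h : StrongTendsto T S) (c : ℝ) : StrongTendsto (fun n => c • T n) (c • S) := by
  simpa using (const (c • (1 : H →L[ℂ] H))).mul h

theorem pow (h : StrongTendsto T S) (k : ℕ) : StrongTendsto (fun n => T n ^ k) (S ^ k) := by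
  induction k with
  | zero => simpa using const 1
  | succ k ih => simpa only [pow_succ] using ih.mul h

theorem aeval (h : StrongTendsto T S) (p : Polynomial ℝ) :
    StrongTendsto (fun n => Polynomial.aeval (T n) p) (Polynomial.aeval S p) := by
  induction p using Polynomial.induction_on' with
  | add p q hp hq => simpa using hp.add hq
  | monomial k c => simpa [Polynomial.aeval_monomial, Algebra.algebraMap_eq_smul_one] using
      (h.pow k).smul c

theorem norm_le (h : StrongTendsto T S) {L : ℝ} (hL : ∀ n, ‖T n‖ ≤ L) : ‖S‖ ≤ L :=
  S.opNorm_le_bound ((norm_nonneg _).trans (hL 0)) fun x =>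
    le_of_tendsto (h.tendsto x).norm (Eventually.of_forall fun n => (T n).le_of_opNorm_le (hL n) x)

theorem of_forall_near (h : ∃ L, ∀ n, ‖T n‖ ≤ L)
    (hnear : ∀ ε : ℝ, 0 < ε → ∃ T' S', StrongTendsto T' S' ∧ (∀ n, ‖T n - T' n‖ ≤ ε) ∧
      ‖S - S'‖ ≤ ε) : StrongTendsto T S := by
  refine ⟨h, fun x => ?_⟩
  rw [Metric.tendsto_atTop]
  intro ε hε
  obtain ⟨T', S', hTS, hT, hS⟩ := hnear (ε / (3 * (‖x‖ + 1))) (by positivity)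
  obtain ⟨N, hN⟩ := Metric.tendsto_atTop.1 (hTS.tendsto x) (ε / 3) (by positivity)
  refine ⟨N, fun n hn => ?_⟩
  have h1 := hN n hn
  have hx : ε / (3 * (‖x‖ + 1)) * ‖x‖ < ε / 3 := by
    rw [div_mul_eq_mul_div, div_lt_div_iff₀ (by positivity) (by positivity)]
    nlinarith [norm_nonneg x]
  have h2 : ‖(T n - T' n) x‖ < ε / 3 := ((T n - T' n).le_of_opNorm_le (hT n) x).trans_lt hx
  have h3 : ‖(S - S') x‖ < ε / 3 := ((S - S').le_of_opNorm_le hS x).trans_lt hx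
  rw [dist_eq_norm] at h1 ⊢
  calc ‖T n x - S x‖ = ‖(T n - T' n) x + (T' n x - S' x) - (S - S') x‖ := by
        congr 1
        simp only [sub_apply]
        abel
    _ ≤ ‖(T n - T' n) x‖ + ‖T' n x - S' x‖ + ‖(S - S') x‖ :=
        (norm_sub_le _ _).trans (add_le_add_left (norm_add_le _ _) _)
    _ < ε := by linarith

theorem cfc (h : StrongTendsto T S) (hT : ∀ n, IsSelfAdjoint (T n)) (hS : IsSelfAdjoint S)
    {f : ℝ → ℝ} (hf : Continuous f) :
    StrongTendsto (fun n => _root_.cfc f (T n)) (_root_.cfc f S) := by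
  obtain ⟨L, hL⟩ := h.bounded
  have hspec : ∀ a : H →L[ℂ] H, ‖a‖ ≤ L → ∀ x ∈ spectrum ℝ a, x ∈ Set.Icc (-L) L := by
    intro a ha x hx
    have h1 := spectrum.norm_le_norm_mul_of_mem hx
    have h2 : ‖(1 : H →L[ℂ] H)‖ ≤ 1 := ContinuousLinearMap.norm_id_le
    exact abs_le.1 (h1.trans ((mul_le_of_le_one_right (norm_nonneg a) h2).trans ha))
  have hnear : ∀ ε : ℝ, 0 < ε → ∃ p : Polynomial ℝ, ∀ a : H →L[ℂ] H, IsSelfAdjoint a →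
      ‖a‖ ≤ L → ‖_root_.cfc f a - Polynomial.aeval a p‖ ≤ ε := by
    intro ε hε
    obtain ⟨p, hp⟩ := exists_polynomial_near_of_continuousOn (-L) L f hf.continuousOn ε hε
    refine ⟨p, fun a ha haL => ?_⟩
    rw [← cfc_polynomial p a, ← cfc_sub f _ a hf.continuousOn p.continuous.continuousOn]
    refine norm_cfc_le hε.le fun x hx => ?_
    rw [norm_sub_rev]
    exact (hp x (hspec a haL x hx)).le
  refine of_forall_near ?_ fun ε hε => ?_
  · obtain ⟨p, hp⟩ := hnear 1 one_pos
    obtain ⟨M, hM⟩ := (h.aeval p).bounded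
    refine ⟨1 + M, fun n => ?_⟩
    simpa using norm_add_le_of_le (hp _ (hT n) (hL n)) (hM n)
  · obtain ⟨p, hp⟩ := hnear ε hε
    exact ⟨_, _, h.aeval p, fun n => hp _ (hT n) (hL n), hp _ hS (h.norm_le hL)⟩

theorem rpow (h : StrongTendsto T S) (hT : ∀ n, 0 ≤ T n) (hS : 0 ≤ S) {r : ℝ} (hr : 0 ≤ r) :
    StrongTendsto (fun n => CFC.rpow (T n) r) (CFC.rpow S r) := by
  have := h.cfc (fun n => .of_nonneg (hT n)) (.of_nonneg hS) (Real.continuous_rpow_const hr)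
  rw [← CFC.rpow_eq_cfc_real hS, funext fun n => (CFC.rpow_eq_cfc_real (hT n)).symm] at this
  exact this

theorem sqrt (h : StrongTendsto T S) (hT : ∀ n, 0 ≤ T n) (hS : 0 ≤ S) :
    StrongTendsto (fun n => CFC.sqrt (T n)) (CFC.sqrt S) := by
  simp only [CFC.sqrt_eq_rpow]
  exact h.rpow hT hS (r := 1 / 2) (by norm_num)

theorem inverse (h : StrongTendsto T S) (hT : ∀ n, IsUnit (T n)) (hS : IsUnit S)
    (hb : ∃ L, ∀ n, ‖Ring.inverse (T n)‖ ≤ L) :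
    StrongTendsto (fun n => Ring.inverse (T n)) (Ring.inverse S) := by
  obtain ⟨L, hL⟩ := hb
  refine ⟨⟨L, hL⟩, fun x => ?_⟩
  have h0 : Tendsto (fun n => L * ‖T n (Ring.inverse S x) - S (Ring.inverse S x)‖) atTop
      (𝓝 0) := by
    simpa using (tendsto_iff_norm_sub_tendsto_zero.1 (h.tendsto (Ring.inverse S x))).const_mul L
  rw [tendsto_iff_norm_sub_tendsto_zero]
  refine squeeze_zero (fun n => norm_nonneg _) (fun n => ?_) h0
  have e : Ring.inverse (T n) x - Ring.inverse S x =
      -(Ring.inverse (T n) (T n (Ring.inverse S x) - S (Ring.inverse S x))) := by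
    rw [map_sub, neg_sub, ← mul_apply_eq_comp S, Ring.mul_inverse_cancel _ hS,
      ← mul_apply_eq_comp (Ring.inverse (T n)) (T n), Ring.inverse_mul_cancel _ (hT n)]
    rfl
  rw [e, norm_neg]
  exact (Ring.inverse (T n)).le_of_opNorm_le (hL n) _

theorem le_of_le (h : StrongTendsto T S) (h' : StrongTendsto T' S') (hle : ∀ n, T n ≤ T' n) :
    S ≤ S' := by
  have hsub : StrongTendsto (fun n => T' n - T n) (S' - S) := by
    simpa [sub_eq_add_neg] using h'.add (h.smul (-1))
  rw [ContinuousLinearMap.le_def, ContinuousLinearMap.isPositive_iff_complex]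
  intro x
  have hlim : Tendsto (fun n => inner ℂ ((T' n - T n) x) x) atTop (𝓝 (inner ℂ ((S' - S) x) x)) :=
    (hsub.tendsto x).inner tendsto_const_nhds
  have hclosed : IsClosed {z : ℂ | (z.re : ℂ) = z ∧ 0 ≤ z.re} :=
    (isClosed_eq (Complex.continuous_ofReal.comp Complex.continuous_re) continuous_id).inter
      (isClosed_le continuous_const Complex.continuous_re)
  exact hclosed.mem_of_tendsto hlim (Eventually.of_forall fun n =>
    (ContinuousLinearMap.isPositive_iff_complex _).1 ((ContinuousLinearMap.le_def _ _).1 (hle n)) x)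

end StrongTendsto

theorem indGM_nonneg {k : ℕ} {A : Fin (k + 1) → (H →L[ℂ] H)} (hA : ∀ i, IsPosDefInv (A i)) :
    0 ≤ indGM k A := by
  cases k with
  | zero => exact (hA 0).1
  | succ k => exact conjugate_nonneg_of_nonneg CFC.rpow_nonneg (CFC.sqrt_nonneg _)

theorem strongTendsto_indGM {k : ℕ} {A : ℕ → Fin (k + 1) → (H →L[ℂ] H)}
    {B : Fin (k + 1) → (H →L[ℂ] H)} (hA : ∀ n i, IsPosDefInv (A n i))
    (hB : ∀ i, IsPosDefInv (B i)) (h : ∀ i, StrongTendsto (fun n => A n i) (B i))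
    (hinv : ∀ i, StrongTendsto (fun n => Ring.inverse (A n i)) (Ring.inverse (B i))) :
    StrongTendsto (fun n => indGM k (A n)) (indGM k B) := by
  induction k with
  | zero => exact h 0
  | succ k ih =>
    have hd := (h (Fin.last _)).sqrt (fun n => (hA n _).1) (hB _).1
    have hc := (hinv (Fin.last _)).sqrt (fun n => (hA n _).inverse.1) (hB _).inverse.1
    have hA' : ∀ n (i : Fin (k + 1)), IsPosDefInv (CFC.sqrt (Ring.inverse (A n (Fin.last _))) *
        A n i.castSucc * CFC.sqrt (Ring.inverse (A n (Fin.last _)))) := fun n i =>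
      (hA n _).conj (hA n _).inverse.sqrt
    have hB' : ∀ i : Fin (k + 1), IsPosDefInv (CFC.sqrt (Ring.inverse (B (Fin.last _))) *
        B i.castSucc * CFC.sqrt (Ring.inverse (B (Fin.last _)))) := fun i =>
      (hB _).conj (hB _).inverse.sqrt
    have key : ∀ a b : H →L[ℂ] H, IsPosDefInv a → IsPosDefInv b →
        Ring.inverse (CFC.sqrt (Ring.inverse b) * a * CFC.sqrt (Ring.inverse b)) =
          CFC.sqrt b * Ring.inverse a * CFC.sqrt b := fun a b ha hb => by
      refine left_inv_eq_right_inv (Ring.inverse_mul_cancel _ (ha.conj hb.inverse.sqrt).2) ?_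
      calc _ = CFC.sqrt (Ring.inverse b) * (a * (CFC.sqrt (Ring.inverse b) * CFC.sqrt b) *
            Ring.inverse a) * CFC.sqrt b := by simp only [mul_assoc]
        _ = 1 := by
          rw [hb.sqrt_inverse_mul_sqrt, mul_one, Ring.mul_inverse_cancel _ ha.2, mul_one,
            hb.sqrt_inverse_mul_sqrt]
    have hG := ih hA' hB' (fun i => (hc.mul (h i.castSucc)).mul hc) (fun i => by
      simpa only [key _ _ (hA _ _) (hA _ _), key _ _ (hB _) (hB _)] using
        (hd.mul (hinv i.castSucc)).mul hd)
    exact (hd.mul (hG.rpow (fun n => indGM_nonneg (hA' n)) (indGM_nonneg hB')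
      (by positivity))).mul hd

/-- A multiple of `a` up to the off-diagonal terms with respect to the projection `q`, weighted
so as to dominate `a`. -/
def dominatingPinching (δ : ℝ) (q a : H →L[ℂ] H) : H →L[ℂ] H :=
  (1 + δ) • ((1 - q) * a * (1 - q)) + (1 + δ⁻¹) • (q * a * q)

section Pinching

variable {δ : ℝ} {q a : H →L[ℂ] H}

theorem le_dominatingPinching (hδ : 0 < δ) (hq : IsSelfAdjoint q) (ha : 0 ≤ a) :
    a ≤ dominatingPinching δ q a := by
  have hm : IsSelfAdjoint (δ • (1 - q) - q) :=
    ((IsSelfAdjoint.all δ).smul ((IsSelfAdjoint.one _).sub hq)).sub hq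
  rw [← sub_nonneg]
  have e : dominatingPinching δ q a - a =
      δ⁻¹ • ((δ • (1 - q) - q) * a * (δ • (1 - q) - q)) := by
    simp only [dominatingPinching, mul_sub, sub_mul, smul_mul_assoc,
      mul_smul_comm, one_mul, mul_one, smul_sub, smul_smul, mul_assoc]
    match_scalars <;> field_simp <;> ring
  rw [e]
  exact smul_nonneg (inv_nonneg.2 hδ.le) (hm.conjugate_nonneg ha)

theorem commute_dominatingPinching (hq : q * q = q) : Commute (dominatingPinching δ q a) q := by
  have h1 : (1 - q) * q = 0 := by rw [sub_mul, one_mul, hq, sub_self]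
  have h2 : q * (1 - q) = 0 := by rw [mul_sub, mul_one, hq, sub_self]
  have h3 : ∀ x, q * ((1 - q) * x) = 0 := fun x => by rw [← mul_assoc, h2, zero_mul]
  have h4 : ∀ x, q * (q * x) = q * x := fun x => by rw [← mul_assoc, hq]
  simp [Commute, SemiconjBy, dominatingPinching, add_mul, mul_add, mul_assoc, h1, h3, h4, hq]

theorem IsPosDefInv.dominatingPinching (hδ : 0 < δ) (hq : IsSelfAdjoint q)
    (ha : IsPosDefInv a) : IsPosDefInv (dominatingPinching δ q a) :=
  IsStrictlyPositive.of_le ha (le_dominatingPinching hδ hq ha.1)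

theorem strongTendsto_dominatingPinching (δ : ℝ) (a : H →L[ℂ] H) {q : ℕ → H →L[ℂ] H}
    (hq : StrongTendsto q 0) :
    StrongTendsto (fun n => dominatingPinching δ (q n) a) ((1 + δ) • a) := by
  have h1 : StrongTendsto (fun n => 1 - q n) 1 := by
    simpa [sub_eq_add_neg] using (StrongTendsto.const 1).add (hq.smul (-1))
  have ha := StrongTendsto.const a
  simpa [dominatingPinching] using (((h1.mul ha).mul h1).smul (1 + δ)).add (((hq.mul ha).mul hq).smul (1 + δ⁻¹))

theorem strongTendsto_inverse_dominatingPinching (hδ : 0 < δ) (ha : IsPosDefInv a)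
    {q : ℕ → H →L[ℂ] H} (hq : StrongTendsto q 0) (hsa : ∀ n, IsSelfAdjoint (q n)) :
    StrongTendsto (fun n => Ring.inverse (dominatingPinching δ (q n) a))
      (Ring.inverse ((1 + δ) • a)) :=
  (strongTendsto_dominatingPinching δ a hq).inverse
    (fun n => (ha.dominatingPinching hδ (hsa n)).2) (ha.smul (by positivity)).2
    ⟨‖Ring.inverse a‖, fun n => CStarAlgebra.norm_le_norm_of_nonneg_of_le
      (ha.dominatingPinching hδ (hsa n)).inverse.1
      (CStarAlgebra.ringInverse_le_ringInverse (le_dominatingPinching hδ (hsa n) ha.1) ha)⟩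

end Pinching

theorem IsPosDefInv.inverse_inverse {a : H →L[ℂ] H} (ha : IsPosDefInv a) :
    Ring.inverse (Ring.inverse a) = a :=
  left_inv_eq_right_inv (Ring.inverse_mul_cancel _ ha.inverse.2) (Ring.inverse_mul_cancel _ ha.2)

theorem IsPosDefInv.inverse_smul_inverse {a : H →L[ℂ] H} (ha : IsPosDefInv a) {t : ℝ}
    (ht : 0 < t) : Ring.inverse (t • Ring.inverse a) = t⁻¹ • a := by
  refine left_inv_eq_right_inv (Ring.inverse_mul_cancel _ (ha.inverse.smul ht).2) ?_
  rw [smul_mul_smul_comm, mul_inv_cancel₀ ht.ne', Ring.inverse_mul_cancel _ ha.2, one_smul]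

theorem IsPosDefInv.commute_inverse {a b : H →L[ℂ] H} (ha : IsPosDefInv a) (h : Commute a b) :
    Commute (Ring.inverse a) b := by
  obtain ⟨u, rfl⟩ := ha.2
  rw [Ring.inverse_unit]
  exact h.units_inv_left

theorem IsPosDefInv.compress {a V : H →L[ℂ] H} (ha : IsPosDefInv a) (hV : star V * V = 1) :
    IsPosDefInv (star V * a * V) := by
  obtain ⟨r, hr, h⟩ := ha.exists_smul_one_le
  have := star_left_conjugate_le_conjugate h V
  rw [mul_smul_comm, smul_mul_assoc, mul_one, hV] at this
  exact IsStrictlyPositive.of_le (isPosDefInv_one.smul hr) this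

theorem strongTendsto_pow_mul_star_pow {W : H →L[ℂ] H} (hW : star W * W = 1)
    (h : ∀ x, Tendsto (fun n => (star W ^ n) x) atTop (𝓝 0)) :
    StrongTendsto (fun n => W ^ (n + 1) * star (W ^ (n + 1))) 0 := by
  have hn : ∀ n, ‖W ^ n‖ ≤ 1 := fun n => by
    refine norm_le_one_of_star_mul_self ?_
    induction n with
    | zero => simp
    | succ n ih => rw [pow_succ', star_mul, mul_assoc, ← mul_assoc (star W), hW, one_mul, ih]
  have hn' : ∀ n, ‖star (W ^ n)‖ ≤ 1 := fun n => (norm_star _).trans_le (hn n)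
  refine ⟨⟨1 * 1, fun n => norm_mul_le_of_le (hn _) (hn' _)⟩, fun x => ?_⟩
  have h0 := (h x).norm.comp (tendsto_add_atTop_nat 1)
  rw [norm_zero] at h0
  refine squeeze_zero_norm (fun n => ?_) h0
  have := (W ^ (n + 1)).le_of_opNorm_le (hn _) (star (W ^ (n + 1)) x)
  rw [one_mul, ← mul_apply_eq_comp] at this
  simpa only [Function.comp_apply, ← star_pow] using this

section Uniqueness

variable {G : (k : ℕ) → (Fin (k + 1) → (H →L[ℂ] H)) → (H →L[ℂ] H)}
    (hG : ∀ k, IsConcaveRegular (G k))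
    (hbase : ∀ A : Fin 1 → (H →L[ℂ] H), IsPosDefInv (A 0) → G 0 A = A 0)
    (hupd : ∀ k, ∀ A : Fin (k + 1) → (H →L[ℂ] H), (∀ i, IsPosDefInv (A i)) →
      G (k + 1) (Fin.snoc A 1) = CFC.rpow (G k A) ((k + 1 : ℝ) / (k + 2)))
    {V W : H →L[ℂ] H} {k : ℕ} {A : Fin (k + 1) → (H →L[ℂ] H)} (hA : ∀ i, IsPosDefInv (A i))
include hG hbase hupd hA

theorem indGM_smul (h : IsCuntzPair V W) {t : ℝ} (ht : 0 < t) :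
    indGM k (fun i => t • A i) = t • indGM k A := by
  rw [← cornerMap_eq_indGM hG hbase hupd h k A hA, ← (hG k).cornerMap_smul h hA ht,
    cornerMap_eq_indGM hG hbase hupd h k _ fun i => (hA i).smul ht]

theorem eq_indGM_of_commute (h : IsCuntzPair V W) (hAW : ∀ i, Commute (A i) (W * star W)) :
    G k A = indGM k A := by
  have hV : ∀ i, IsPosDefInv (star V * A i * V) := fun i => (hA i).compress h.left
  have hW : ∀ i, IsPosDefInv (star W * A i * W) := fun i => (hA i).compress h.right
  have e : A = fun i => blockSum V W (star V * A i * V) (star W * A i * W) :=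
    funext fun i => h.eq_blockSum_of_commute (hAW i)
  rw [← cornerMap_eq_indGM hG hbase hupd h k A hA, e, (hG k).map_blockSum h h hV hW,
    (hG k).cornerMap_blockSum h hV hW]

variable (h : IsCuntzPair V W) (hlim : ∀ x, Tendsto (fun n => (star W ^ n) x) atTop (𝓝 0))
include h hlim

theorem le_indGM : G k A ≤ indGM k A := by
  refine le_of_forall_le_one_add_smul fun δ hδ => ?_
  set q : ℕ → H →L[ℂ] H := fun n => W ^ (n + 1) * star (W ^ (n + 1))
  have hq : StrongTendsto q 0 := strongTendsto_pow_mul_star_pow h.right hlim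
  have hsa : ∀ n, IsSelfAdjoint (q n) := fun n => .mul_star_self _
  have hB : ∀ n i, IsPosDefInv (dominatingPinching δ (q n) (A i)) := fun n i =>
    (hA i).dominatingPinching hδ (hsa n)
  have hδ1 : 0 < 1 + δ := by positivity
  rw [← indGM_smul hG hbase hupd hA h hδ1]
  refine (StrongTendsto.const (G k A)).le_of_le (strongTendsto_indGM hB
    (fun i => (hA i).smul hδ1) (fun i => strongTendsto_dominatingPinching δ (A i) hq)
    fun i => strongTendsto_inverse_dominatingPinching hδ (hA i) hq hsa) fun n => ?_
  obtain ⟨V', h'⟩ := h.exists_pow n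
  rw [← eq_indGM_of_commute hG hbase hupd (hB n) h' fun i =>
    commute_dominatingPinching (by simp only [q, mul_assoc, h'.right_mul])]
  exact (hG k).monotone hA fun i => le_dominatingPinching hδ (hsa n) (hA i).1

theorem indGM_le : indGM k A ≤ G k A := by
  refine le_of_forall_le_one_add_smul fun δ hδ => ?_
  set q : ℕ → H →L[ℂ] H := fun n => W ^ (n + 1) * star (W ^ (n + 1))
  have hq : StrongTendsto q 0 := strongTendsto_pow_mul_star_pow h.right hlim
  have hsa : ∀ n, IsSelfAdjoint (q n) := fun n => .mul_star_self _
  have hP : ∀ n i, IsPosDefInv (dominatingPinching δ (q n) (Ring.inverse (A i))) := fun n i =>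
    (hA i).inverse.dominatingPinching hδ (hsa n)
  have hδ1 : 0 < 1 + δ := by positivity
  have hC : ∀ i, IsPosDefInv ((1 + δ) • Ring.inverse (A i)) := fun i => (hA i).inverse.smul hδ1
  rw [← inv_smul_le_iff_of_pos hδ1, ← indGM_smul hG hbase hupd hA h (inv_pos.2 hδ1),
    ← funext fun i => (hA i).inverse_smul_inverse hδ1]
  refine (strongTendsto_indGM (fun n i => (hP n i).inverse) (fun i => (hC i).inverse)
    (fun i => strongTendsto_inverse_dominatingPinching hδ (hA i).inverse hq hsa)
    fun i => ?_).le_of_le (StrongTendsto.const (G k A)) fun n => ?_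
  · simpa only [(hP _ i).inverse_inverse, (hC i).inverse_inverse] using
      strongTendsto_dominatingPinching δ (Ring.inverse (A i)) hq
  · obtain ⟨V', h'⟩ := h.exists_pow n
    have hcomm : ∀ i, Commute (dominatingPinching δ (q n) (Ring.inverse (A i))) (q n) := fun i =>
      commute_dominatingPinching (by simp only [q, mul_assoc, h'.right_mul])
    rw [← eq_indGM_of_commute hG hbase hupd (fun i => (hP n i).inverse) h' fun i =>
      (hP n i).commute_inverse (hcomm i)]
    refine (hG k).monotone (fun i => (hP n i).inverse) fun i => ?_
    conv_rhs => rw [← (hA i).inverse_inverse]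
    exact CStarAlgebra.ringInverse_le_ringInverse
      (le_dominatingPinching hδ (hsa n) (hA i).inverse.1) (hA i).inverse

end Uniqueness

/-- **Uniqueness of the inductive geometric mean.** Any family of mappings `G̃ₖ` of `k`-tuples
of positive definite invertible operators into positive operators with `G̃₁(A) = A` which is
regular, positively homogeneous, concave, and satisfies the updating condition
`G̃_{k+1}(A₁,…,Aₖ,1) = G̃ₖ(A₁,…,Aₖ)^{k/(k+1)}` coincides with the inductive geometric mean. -/
theorem indGM_unique
    (hH : ¬ FiniteDimensional ℂ H)
    (G : (k : ℕ) → (Fin (k + 1) → (H →L[ℂ] H)) → (H →L[ℂ] H))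
    (hpos : ∀ k, ∀ A : Fin (k + 1) → (H →L[ℂ] H), (∀ i, IsPosDefInv (A i)) → 0 ≤ G k A)
    (hbase : ∀ A : Fin 1 → (H →L[ℂ] H), IsPosDefInv (A 0) → G 0 A = A 0)
    (hreg₁ : ∀ k, ∀ u ∈ unitary (H →L[ℂ] H), ∀ A : Fin (k + 1) → (H →L[ℂ] H),
      (∀ i, IsPosDefInv (A i)) →
      G k (fun i => star u * A i * u) = star u * G k A * u)
    (hreg₂ : ∀ k, ∀ p q : H →L[ℂ] H, IsSelfAdjoint p → IsIdempotentElem p →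
      IsSelfAdjoint q → IsIdempotentElem q → p * q = 0 →
      ∀ A B : Fin (k + 1) → (H →L[ℂ] H),
        (∀ i, IsCornerPosDef p (p * A i * p)) → (∀ i, IsCornerPosDef q (q * B i * q)) →
        G k (fun i => p * A i * p + q * B i * q) =
          p * G k (fun i => p * A i * p) * p + q * G k (fun i => q * B i * q) * q)
    (hhom : ∀ k, ∀ t : ℝ, 0 < t → ∀ A : Fin (k + 1) → (H →L[ℂ] H),
      (∀ i, IsPosDefInv (A i)) → G k (fun i => t • A i) = t • G k A)
    (hconc : ∀ k, ∀ A B : Fin (k + 1) → (H →L[ℂ] H),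
      (∀ i, IsPosDefInv (A i)) → (∀ i, IsPosDefInv (B i)) →
      ∀ t : ℝ, 0 ≤ t → t ≤ 1 →
        t • G k A + (1 - t) • G k B ≤ G k (fun i => t • A i + (1 - t) • B i))
    (hupd : ∀ k, ∀ A : Fin (k + 1) → (H →L[ℂ] H), (∀ i, IsPosDefInv (A i)) →
      G (k + 1) (Fin.snoc A 1) = CFC.rpow (G k A) ((k + 1 : ℝ) / (k + 2))) :
    ∀ k, ∀ A : Fin (k + 1) → (H →L[ℂ] H), (∀ i, IsPosDefInv (A i)) →
      G k A = indGM k A := by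
  intro k A hA
  have hG : ∀ k, IsConcaveRegular (G k) := fun k =>
    ⟨hpos k, hreg₁ k, hreg₂ k, hhom k, hconc k⟩
  obtain ⟨V, W, h, hlim⟩ := exists_isCuntzPair_tendsto hH
  exact le_antisymm (le_indGM hG hbase hupd hA h hlim) (indGM_le hG hbase hupd hA h hlim)
end
end

section
/- Let H be an infinite-dimensional complex Hilbert space. For every k ≥ 1, the inductive geometric mean Gₖ is monotone increasing in each variable: if A₁ ≤ B₁, …, Aₖ ≤ Bₖ are positive definite invertible bounded operators on H (in the Loewner order), then Gₖ(A₁,…,Aₖ) ≤ Gₖ(B₁,…,Bₖ). -/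
set_option synthInstance.maxHeartbeats 400000
set_option maxHeartbeats 1000000

noncomputable section

variable {H : Type*} [NormedAddCommGroup H] [InnerProductSpace ℂ H] [CompleteSpace H]

/-- The weighted operator geometric mean `a #_t b`. -/
def weightedGM {R : Type*} [CStarAlgebra R] [PartialOrder R] [StarOrderedRing R]
    (a b : R) (t : ℝ) : R :=
  CFC.sqrt a * (CFC.sqrt (Ring.inverse a) * b * CFC.sqrt (Ring.inverse a)) ^ t * CFC.sqrt a

section CStarAlgebra

variable {R : Type*} [CStarAlgebra R] [PartialOrder R] [StarOrderedRing R]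

theorem IsStrictlyPositive.units_star_conj {a : R} (ha : IsStrictlyPositive a) (c : Rˣ) :
    IsStrictlyPositive (star (c : R) * a * c) :=
  ⟨star_left_conjugate_nonneg ha.nonneg _, (c.isUnit.star.mul ha.isUnit).mul c.isUnit⟩

theorem IsStrictlyPositive.units_conj_star {a : R} (ha : IsStrictlyPositive a) (c : Rˣ) :
    IsStrictlyPositive ((c : R) * a * star (c : R)) :=
  ⟨star_right_conjugate_nonneg ha.nonneg _, (c.isUnit.mul ha.isUnit).mul c.isUnit.star⟩

theorem exists_unit_sqrt {a : R} (ha : IsStrictlyPositive a) :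
    ∃ s : Rˣ, (s : R) = CFC.sqrt a ∧ ((s⁻¹ : Rˣ) : R) = CFC.sqrt (Ring.inverse a) ∧
      star s = s ∧ (s * s : R) = a := by
  obtain ⟨s, hs⟩ := ha.isUnit_cfcSqrt
  refine ⟨s, hs, ?_, ?_, ?_⟩
  · rw [CFC.sqrt_ringInverse, ← hs, Ring.inverse_unit]
  · ext
    rw [Units.coe_star, hs]
    exact (IsSelfAdjoint.of_nonneg (CFC.sqrt_nonneg a)).star_eq
  · rw [hs, CFC.sqrt_mul_sqrt_self a ha.nonneg]

theorem unitary_conj_rpow (u : unitary R) {a : R} (ha : IsStrictlyPositive a) (t : ℝ) :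
    ((u : R) * a * star (u : R)) ^ t = u * a ^ t * star (u : R) := by
  have hpos : IsStrictlyPositive ((u : R) * a * star (u : R)) :=
    ha.units_conj_star (Unitary.toUnits u)
  have hmap := StarAlgHomClass.map_cfc (S := ℂ) (Unitary.conjStarAlgAut ℂ R u)
    (fun x : NNReal => x ^ t) a
    (hf := NNReal.continuousOn_rpow_const (.inl (spectrum.zero_notMem NNReal ha.isUnit)))
    (hφ := by
      change Continuous fun x : R => (u : R) * x * star (u : R)
      fun_prop) (ha := ha.nonneg)
    (hφa := by simpa only [Unitary.conjStarAlgAut_apply] using hpos.nonneg)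
  simpa only [Unitary.conjStarAlgAut_apply, CFC.rpow_def] using hmap.symm

/-- The weighted geometric mean may be computed from any factorization `a = c c*`. -/
theorem weightedGM_eq_of_factorization {a b : R} (ha : IsStrictlyPositive a)
    (hb : IsStrictlyPositive b) (c : Rˣ) (hc : (c : R) * star (c : R) = a) (t : ℝ) :
    weightedGM a b t =
      c * (((c⁻¹ : Rˣ) : R) * b * star ((c⁻¹ : Rˣ) : R)) ^ t * star (c : R) := by
  obtain ⟨s, hs, hs', hstar, hss⟩ := exists_unit_sqrt ha
  have hcs : c * star c = s * s := by ext; simp [hc, hss]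
  have hu : s⁻¹ * c ∈ unitary Rˣ := by
    have h1 : (s⁻¹ * c) * star (s⁻¹ * c) = 1 := by
      rw [star_mul, star_inv, hstar, mul_assoc, ← mul_assoc c, hcs]; group
    exact ⟨by rw [mul_eq_one_comm]; exact h1, h1⟩
  let u : unitary R := ⟨((s⁻¹ * c : Rˣ) : R), by
    constructor
    · rw [← Units.coe_star, ← Units.val_mul, hu.1, Units.val_one]
    · rw [← Units.coe_star, ← Units.val_mul, hu.2, Units.val_one]⟩
  have hsu : (s : R) * u = c := by simp [u]
  have hstar' : star (s : R) = s := by rw [← Units.coe_star, hstar]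
  have huc : (u : R) * ((c⁻¹ : Rˣ) : R) = ((s⁻¹ : Rˣ) : R) := by simp [u]
  have hinv : star ((s⁻¹ : Rˣ) : R) = ((s⁻¹ : Rˣ) : R) := by
    rw [← Units.coe_star, star_inv, hstar]
  have hcu : star ((c⁻¹ : Rˣ) : R) * star (u : R) = ((s⁻¹ : Rˣ) : R) := by
    rw [← star_mul, huc, hinv]
  have hkey := unitary_conj_rpow u (hb.units_conj_star c⁻¹) t
  have heq : (u : R) * (((c⁻¹ : Rˣ) : R) * b * star ((c⁻¹ : Rˣ) : R)) * star (u : R)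
      = ((s⁻¹ : Rˣ) : R) * b * ((s⁻¹ : Rˣ) : R) := by
    simp only [mul_assoc, hcu]
    rw [← mul_assoc, huc]
  rw [heq] at hkey
  rw [weightedGM, ← hs, ← hs', hkey, ← hsu, star_mul, hstar']
  simp only [mul_assoc]

theorem weightedGM_isStrictlyPositive {a b : R} (ha : IsStrictlyPositive a)
    (hb : IsStrictlyPositive b) (t : ℝ) : IsStrictlyPositive (weightedGM a b t) := by
  obtain ⟨s, hs, hs', hstar, -⟩ := exists_unit_sqrt ha
  have hstar' : star (s : R) = s := by rw [← Units.coe_star, hstar]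
  have hinv : star ((s⁻¹ : Rˣ) : R) = ((s⁻¹ : Rˣ) : R) := by
    rw [← Units.coe_star, star_inv, hstar]
  have h1 := hb.units_conj_star s⁻¹
  have h2 := (IsStrictlyPositive.rpow _ t h1).units_conj_star s
  rwa [hinv, hstar', hs', hs] at h2

/-- Congruence invariance of the weighted geometric mean. -/
theorem weightedGM_units_star_conj {a b : R} (ha : IsStrictlyPositive a)
    (hb : IsStrictlyPositive b) (c : Rˣ) (t : ℝ) :
    weightedGM (star (c : R) * a * c) (star (c : R) * b * c) t =
      star (c : R) * weightedGM a b t * c := by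
  obtain ⟨s, hs, hs', hstar, hss⟩ := exists_unit_sqrt ha
  have hstar' : star (s : R) = s := by rw [← Units.coe_star, hstar]
  have hfac : ((star c * s : Rˣ) : R) * star ((star c * s : Rˣ) : R) = star (c : R) * a * c := by
    simp only [Units.val_mul, Units.coe_star, star_mul, star_star, hstar', ← hss, mul_assoc]
  have hinv : star ((s⁻¹ : Rˣ) : R) = ((s⁻¹ : Rˣ) : R) := by
    rw [← Units.coe_star, star_inv, hstar]
  have hmid : (((star c * s)⁻¹ : Rˣ) : R) * (star (c : R) * b * c) *
      star (((star c * s)⁻¹ : Rˣ) : R) = ((s⁻¹ : Rˣ) : R) * b * ((s⁻¹ : Rˣ) : R) := by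
    have h1 : (((star c)⁻¹ : Rˣ) : R) * star (c : R) = 1 := by
      rw [← Units.coe_star, Units.inv_mul]
    have h2 : (c : R) * star (((star c)⁻¹ : Rˣ) : R) = 1 := by
      rw [← Units.coe_star, star_inv, star_star, Units.mul_inv]
    calc _ = ((s⁻¹ : Rˣ) : R) * ((((star c)⁻¹ : Rˣ) : R) * star (c : R)) * b *
          ((c : R) * star (((star c)⁻¹ : Rˣ) : R)) * ((s⁻¹ : Rˣ) : R) := by
            simp only [mul_inv_rev, Units.val_mul, star_mul, hinv, mul_assoc]
      _ = _ := by rw [h1, h2, mul_one, mul_one]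
  rw [weightedGM_eq_of_factorization (ha.units_star_conj c) (hb.units_star_conj c) _ hfac, hmid,
    weightedGM, ← hs, ← hs']
  simp only [Units.val_mul, Units.coe_star, star_mul, star_star, hstar', mul_assoc]

/-- Swapping the arguments of the weighted geometric mean. -/
theorem weightedGM_symm {a b : R} (ha : IsStrictlyPositive a)
    (hb : IsStrictlyPositive b) (t : ℝ) :
    weightedGM a b t = weightedGM b a (1 - t) := by
  obtain ⟨s, hs, hs', hstar, hss⟩ := exists_unit_sqrt ha
  have hstar' : star (s : R) = s := by rw [← Units.coe_star, hstar]
  have hinv : star ((s⁻¹ : Rˣ) : R) = ((s⁻¹ : Rˣ) : R) := by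
    rw [← Units.coe_star, star_inv, hstar]
  have hy := hb.units_conj_star s⁻¹
  rw [hinv] at hy
  set y : R := ((s⁻¹ : Rˣ) : R) * b * ((s⁻¹ : Rˣ) : R) with hydef
  obtain ⟨r, hr, hr', hrstar, hrr⟩ := exists_unit_sqrt hy
  have hrstar' : star (r : R) = r := by rw [← Units.coe_star, hrstar]
  have hrinv : star ((r⁻¹ : Rˣ) : R) = ((r⁻¹ : Rˣ) : R) := by
    rw [← Units.coe_star, star_inv, hrstar]
  have hfac : ((s * r : Rˣ) : R) * star ((s * r : Rˣ) : R) = b := by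
    calc _ = (s : R) * (r * r) * s := by
            simp only [Units.val_mul, star_mul, hstar', hrstar', mul_assoc]
      _ = b := by rw [hrr, hydef]; simp [mul_assoc]
  have hmid : (((s * r)⁻¹ : Rˣ) : R) * a * star (((s * r)⁻¹ : Rˣ) : R) = y ^ (-1 : ℝ) := by
    have hyr : ((r * r : Rˣ) : R) = y := hrr
    have hpos : (0 : R) ≤ ((r * r : Rˣ) : R) := hyr ▸ hy.nonneg
    rw [← hyr, CFC.rpow_neg_one_eq_inv _ hpos]
    simp only [mul_inv_rev, Units.val_mul, star_mul, hinv, hrinv, ← hss, mul_assoc,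
      Units.inv_mul_cancel_left, Units.mul_inv_cancel_left]
  rw [weightedGM_eq_of_factorization hb ha _ hfac, hmid,
    CFC.rpow_rpow y _ _ (by norm_num) hy, weightedGM, ← hs, ← hs', ← hydef]
  have hpow : y ^ t = r * y ^ (-1 * (1 - t)) * r := by
    rw [hr, CFC.sqrt_eq_rpow, ← CFC.rpow_add hy.isUnit, ← CFC.rpow_add hy.isUnit]
    congr 1
    ring
  rw [hpow]
  simp only [Units.val_mul, star_mul, hstar', hrstar', mul_assoc]

theorem weightedGM_le_weightedGM_right {a b b' : R} (h : b ≤ b') {t : ℝ}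
    (ht : t ∈ Set.Icc 0 1) : weightedGM a b t ≤ weightedGM a b' t :=
  conjugate_le_conjugate_of_nonneg
    (CFC.rpow_le_rpow ht (conjugate_le_conjugate_of_nonneg h (CFC.sqrt_nonneg _)))
    (CFC.sqrt_nonneg _)

/-- The weighted geometric mean is jointly monotone. -/
theorem weightedGM_le_weightedGM {a a' b b' : R} (ha : IsStrictlyPositive a)
    (hb : IsStrictlyPositive b) (haa : a ≤ a') (hbb : b ≤ b') {t : ℝ}
    (ht : t ∈ Set.Icc 0 1) : weightedGM a b t ≤ weightedGM a' b' t := by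
  refine (weightedGM_le_weightedGM_right hbb ht).trans ?_
  have hb' := hb.of_le hbb
  rw [weightedGM_symm ha hb', weightedGM_symm (ha.of_le haa) hb']
  exact weightedGM_le_weightedGM_right haa ⟨by linarith [ht.2], by linarith [ht.1]⟩

end CStarAlgebra

/-- The recursion for the inductive geometric mean in terms of the weighted geometric mean. -/
theorem indGM_succ (k : ℕ) (A : Fin (k + 2) → (H →L[ℂ] H))
    (hlast : IsStrictlyPositive (A (Fin.last (k + 1))))
    (hconj : ∀ c : (H →L[ℂ] H)ˣ,
      indGM k (fun i => star (c : H →L[ℂ] H) * A i.castSucc * (c : H →L[ℂ] H)) =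
        star (c : H →L[ℂ] H) * indGM k (fun i => A i.castSucc) * (c : H →L[ℂ] H)) :
    indGM (k + 1) A = weightedGM (A (Fin.last (k + 1))) (indGM k fun i => A i.castSucc)
      ((k + 1 : ℝ) / (k + 2)) := by
  obtain ⟨s, -, hs', hstar, -⟩ := exists_unit_sqrt hlast
  have h := hconj s⁻¹
  rw [← Units.coe_star, star_inv, hstar, hs'] at h
  rw [indGM, h]
  rfl

/-- Positivity and congruence invariance of the inductive geometric mean. -/
theorem indGM_isStrictlyPositive_and_units_star_conj (k : ℕ) (A : Fin (k + 1) → (H →L[ℂ] H))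
    (hA : ∀ i, IsStrictlyPositive (A i)) :
    IsStrictlyPositive (indGM k A) ∧ ∀ c : (H →L[ℂ] H)ˣ,
      indGM k (fun i => star (c : H →L[ℂ] H) * A i * (c : H →L[ℂ] H)) =
        star (c : H →L[ℂ] H) * indGM k A * (c : H →L[ℂ] H) := by
  induction k with
  | zero => exact ⟨hA 0, fun c => rfl⟩
  | succ k ih =>
    have hlast := hA (Fin.last (k + 1))
    obtain ⟨hpos, hconj⟩ := ih (fun i => A i.castSucc) fun i => hA i.castSucc
    rw [indGM_succ k A hlast hconj]
    refine ⟨weightedGM_isStrictlyPositive hlast hpos _, fun c => ?_⟩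
    have hconj' := (ih (fun i => star (c : H →L[ℂ] H) * A i.castSucc * (c : H →L[ℂ] H))
      fun i => (hA i.castSucc).units_star_conj c).2
    rw [indGM_succ k (fun i => star (c : H →L[ℂ] H) * A i * (c : H →L[ℂ] H))
      (hlast.units_star_conj c) hconj', hconj c, weightedGM_units_star_conj hlast hpos]

/-- **Monotonicity of the inductive geometric mean.** If `Aᵢ ≤ Bᵢ` in the Loewner order for
positive definite invertible operators, then `Gₖ(A₁,…,Aₖ) ≤ Gₖ(B₁,…,Bₖ)`. -/
theorem indGM_monotone
    (hH : ¬ FiniteDimensional ℂ H) (k : ℕ)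
    (A B : Fin (k + 1) → (H →L[ℂ] H))
    (hA : ∀ i, IsPosDefInv (A i)) (hB : ∀ i, IsPosDefInv (B i))
    (hAB : ∀ i, A i ≤ B i) :
    indGM k A ≤ indGM k B := by
  clear hH
  induction k with
  | zero => exact hAB 0
  | succ k ih =>
    have hA' : ∀ i, IsStrictlyPositive (A i) := hA
    have hB' : ∀ i, IsStrictlyPositive (B i) := hB
    obtain ⟨hpos, hconjA⟩ :=
      indGM_isStrictlyPositive_and_units_star_conj k (fun i => A i.castSucc) fun i => hA' _
    obtain ⟨-, hconjB⟩ :=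
      indGM_isStrictlyPositive_and_units_star_conj k (fun i => B i.castSucc) fun i => hB' _
    rw [indGM_succ k A (hA' _) hconjA, indGM_succ k B (hB' _) hconjB]
    refine weightedGM_le_weightedGM (hA' _) hpos (hAB _)
      (ih _ _ (fun i => hA _) (fun i => hB _) fun i => hAB _) ⟨by positivity, ?_⟩
    rw [div_le_one (by positivity)]
    linarith
end
end
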